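/- arXiv:alg-geom/9410010 — 2 statements merged into one kernel-verified Lean document; each statement's English description precedes it below -/
import Mathlib

section
/- Let k be an algebraically closed field. Let A and B be reduced commutative rings containing k (i.e. reduced commutative k-algebras) whose prime spectra are connected. Then every unit u of A ⊗_k B has the form u = a ⊗ b for some units a ∈ A^× and b ∈ B^×. -/
universe u

open TensorProduct

section Points

variable {k : Type*} [Field k] [IsAlgClosed k]

/-- Over an algebraically closed field, a non-nilpotent element of a finitely generated algebra
does not vanish at some rational point. -/
lemma exists_algHom_apply_ne_zero {B : Type*} [CommRing B] [Algebra k B]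
    [Algebra.FiniteType k B] {b : B} (hb : ¬ IsNilpotent b) : ∃ y : B →ₐ[k] k, y b ≠ 0 := by
  have : Nontrivial (Localization.Away b) := by
    rw [← not_subsingleton_iff_nontrivial,
      IsLocalization.subsingleton_iff (M := Submonoid.powers b)]
    rintro ⟨n, hn⟩
    exact hb ⟨n, hn⟩
  obtain ⟨m, hm⟩ := Ideal.exists_maximal (Localization.Away b)
  let : Field (Localization.Away b ⧸ m) := Ideal.Quotient.field m
  have : Algebra.FiniteType k (Localization.Away b ⧸ m) :=
    Algebra.FiniteType.of_surjective (Ideal.Quotient.mkₐ k m) Ideal.Quotient.mk_surjective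
  have : Module.Finite k (Localization.Away b ⧸ m) :=
    finite_of_finite_type_of_isJacobsonRing k _
  let ψ : (Localization.Away b ⧸ m) →ₐ[k] k := IsAlgClosed.lift
  refine ⟨(ψ.comp (Ideal.Quotient.mkₐ k m)).comp
    (IsScalarTower.toAlgHom k B (Localization.Away b)), ?_⟩
  exact ((IsLocalization.Away.algebraMap_isUnit (S := Localization.Away b) b).map
    (ψ.comp (Ideal.Quotient.mkₐ k m))).ne_zero

lemma exists_algHom_of_nontrivial (k B : Type*) [Field k] [IsAlgClosed k] [CommRing B]
    [Algebra k B] [Algebra.FiniteType k B] [Nontrivial B] : Nonempty (B →ₐ[k] k) :=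
  let ⟨y, _⟩ := exists_algHom_apply_ne_zero (k := k) (b := (1 : B)) not_isNilpotent_one
  ⟨y⟩

end Points

section Evaluation

variable {k : Type*} [Field k]

/-- Evaluation of the right tensor factor at a rational point. -/
noncomputable def evalRight (E : Type*) {B : Type*} [CommRing E] [Algebra k E] [CommRing B]
    [Algebra k B] (y : B →ₐ[k] k) : E ⊗[k] B →ₐ[k] E :=
  (Algebra.TensorProduct.rid k k E).toAlgHom.comp
    (Algebra.TensorProduct.map (AlgHom.id k E) y)

@[simp]
lemma evalRight_tmul {E B : Type*} [CommRing E] [Algebra k E] [CommRing B] [Algebra k B]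
    (y : B →ₐ[k] k) (e : E) (b : B) : evalRight E y (e ⊗ₜ b) = y b • e := by
  simp [evalRight]

lemma evalRight_map {E F B : Type*} [CommRing E] [Algebra k E] [CommRing F] [Algebra k F]
    [CommRing B] [Algebra k B] (f : E →ₐ[k] F) (y : B →ₐ[k] k) (x : E ⊗[k] B) :
    evalRight F y (Algebra.TensorProduct.map f (AlgHom.id k B) x) = f (evalRight E y x) := by
  induction x with
  | zero => simp
  | tmul e b => simp
  | add x x' hx hx' => simp only [map_add, hx, hx']

variable [IsAlgClosed k] {E B : Type*} [CommRing E] [Algebra k E] [CommRing B] [Algebra k B]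
  [Algebra.FiniteType k B]

omit [IsAlgClosed k] [Algebra.FiniteType k B] in
lemma exists_evalRight_ne_zero {x : E ⊗[k] B} (hx : x ≠ 0) :
    ∃ b : B, b ≠ 0 ∧ ∀ y : B →ₐ[k] k, y b ≠ 0 → evalRight E y x ≠ 0 := by
  classical
  let ℰ := Module.Free.chooseBasis k E
  obtain ⟨i, hi⟩ : ∃ i, equivFinsuppOfBasisLeft ℰ x i ≠ 0 := by
    by_contra! h
    exact hx ((equivFinsuppOfBasisLeft ℰ).injective (Finsupp.ext fun i ↦ by simp [h]))
  have key (y : B →ₐ[k] k) (z : E ⊗[k] B) :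
      ℰ.repr (evalRight E y z) i = y (equivFinsuppOfBasisLeft ℰ z i) := by
    induction z with
    | zero => simp
    | tmul e b => simp [mul_comm]
    | add z z' hz hz' => simp only [map_add, Finsupp.add_apply, hz, hz']
  refine ⟨_, hi, fun y hy h ↦ hy ?_⟩
  rw [← key, h]
  simp

lemma eq_zero_of_forall_evalRight_eq_zero [IsReduced B] {x : E ⊗[k] B}
    (h : ∀ y : B →ₐ[k] k, evalRight E y x = 0) : x = 0 := by
  by_contra hx
  obtain ⟨b, hb, hbx⟩ := exists_evalRight_ne_zero hx
  obtain ⟨y, hy⟩ := exists_algHom_apply_ne_zero (k := k) (b := b)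
    (by rwa [isNilpotent_iff_eq_zero])
  exact hbx y hy (h y)

/-- Over an algebraically closed field, the tensor product of a domain with a finitely generated
domain is a domain. -/
lemma noZeroDivisors_tensorProduct [IsDomain E] [IsDomain B] : NoZeroDivisors (E ⊗[k] B) where
  eq_zero_or_eq_zero_of_mul_eq_zero {x z} hxz := by
    by_contra! h
    obtain ⟨b, hb, hbx⟩ := exists_evalRight_ne_zero h.1
    obtain ⟨c, hc, hcz⟩ := exists_evalRight_ne_zero h.2
    obtain ⟨y, hy⟩ := exists_algHom_apply_ne_zero (k := k) (b := b * c)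
      (by rw [isNilpotent_iff_eq_zero]; exact mul_ne_zero hb hc)
    rw [map_mul] at hy
    apply mul_ne_zero (hbx y (left_ne_zero_of_mul hy)) (hcz y (right_ne_zero_of_mul hy))
    rw [← map_mul, hxz, map_zero]

end Evaluation

section Coordinates

variable {k E F D ι : Type*} [Field k] [CommRing E] [Algebra k E] [CommRing F] [Algebra k F]
  [CommRing D] [Algebra k D] [DecidableEq ι]

lemma equivFinsuppOfBasisRight_map (𝒟 : Module.Basis ι k D) (f : E →ₐ[k] F) (x : E ⊗[k] D)
    (i : ι) :
    equivFinsuppOfBasisRight 𝒟 (Algebra.TensorProduct.map f (AlgHom.id k D) x) i =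
      f (equivFinsuppOfBasisRight 𝒟 x i) := by
  induction x with
  | zero => simp
  | tmul e d => simp
  | add x x' hx hx' => simp only [map_add, Finsupp.add_apply, hx, hx']

lemma equivFinsuppOfBasisRight_tmul_one_mul (𝒟 : Module.Basis ι k D) (c : E) (x : E ⊗[k] D)
    (i : ι) :
    equivFinsuppOfBasisRight 𝒟 ((c ⊗ₜ 1) * x) i = c * equivFinsuppOfBasisRight 𝒟 x i := by
  induction x with
  | zero => simp
  | tmul e d => simp
  | add x x' hx hx' => simp only [mul_add, map_add, Finsupp.add_apply, hx, hx']

end Coordinates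

section Normalize

variable {k K : Type*} (O : Type*) {D : Type*} [Field k] [CommRing O] [IsDomain O]
  [ValuationRing O] [Field K] [Algebra O K] [IsFractionRing O K] [Algebra k O] [Algebra k K]
  [IsScalarTower k O K] [CommRing D] [Algebra k D]

omit [IsDomain O] [ValuationRing O] [IsFractionRing O K] in
lemma mem_range_algebraMap_of_map_eq_tmul_one [Nontrivial D] {w : K} {x : O ⊗[k] D}
    (h : Algebra.TensorProduct.map (IsScalarTower.toAlgHom k O K) (AlgHom.id k D) x =
      w ⊗ₜ[k] 1) : ∃ a : O, algebraMap O K a = w := by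
  classical
  let 𝒟 := Module.Free.chooseBasis k D
  obtain ⟨i, hi⟩ : ∃ i, 𝒟.repr 1 i ≠ 0 := by
    by_contra! h
    exact one_ne_zero (𝒟.repr.injective (Finsupp.ext fun i ↦ by simp [h]) : (1 : D) = 0)
  have := equivFinsuppOfBasisRight_map 𝒟 (IsScalarTower.toAlgHom k O K) x i
  rw [h, equivFinsuppOfBasisRight_apply_tmul_apply] at this
  refine ⟨(𝒟.repr 1 i)⁻¹ • equivFinsuppOfBasisRight 𝒟 x i, ?_⟩
  rw [← IsScalarTower.toAlgHom_apply k O K, map_smul, ← this, inv_smul_smul₀ hi]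

lemma exists_primitive_multiple {x : K ⊗[k] D} (hx : x ≠ 0) :
    ∃ c : K, c ≠ 0 ∧ ∃ x' : O ⊗[k] D,
      Algebra.TensorProduct.map (IsScalarTower.toAlgHom k O K) (AlgHom.id k D) x' =
        (c ⊗ₜ 1) * x ∧
      Algebra.TensorProduct.map (IsScalarTower.toAlgHom k O (IsLocalRing.ResidueField O))
        (AlgHom.id k D) x' ≠ 0 := by
  classical
  let 𝒟 := Module.Free.chooseBasis k D
  set f := equivFinsuppOfBasisRight 𝒟 x with hf
  have hf0 : f ≠ 0 := by simpa [hf] using hx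
  obtain ⟨i, hi, hmax⟩ := f.support.exists_max_image
    (fun i ↦ ValuationRing.valuation O K (f i)) (Finsupp.support_nonempty_iff.mpr hf0)
  have hfi : f i ≠ 0 := Finsupp.mem_support_iff.mp hi
  have hint (j) : ∃ a : O, algebraMap O K a = (f i)⁻¹ * f j := by
    rw [← ValuationRing.mem_integer_iff, Valuation.mem_integer_iff, map_mul, map_inv₀]
    by_cases hj : f j = 0
    · simp [hj]
    · refine inv_mul_le_one_of_le₀ (hmax j (Finsupp.mem_support_iff.mpr hj)) zero_le
  choose a ha using hint
  let g : _ →₀ O := Finsupp.onFinset f.support a fun j hj ↦ by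
    rw [Finsupp.mem_support_iff]
    intro h
    apply hj
    apply IsFractionRing.injective O K
    simp [ha, h]
  have hgi : g i = 1 := by
    apply IsFractionRing.injective O K
    simp [g, ha, hfi]
  refine ⟨(f i)⁻¹, inv_ne_zero hfi, (equivFinsuppOfBasisRight 𝒟).symm g, ?_, ?_⟩
  · apply (equivFinsuppOfBasisRight 𝒟).injective
    ext j
    rw [equivFinsuppOfBasisRight_map, equivFinsuppOfBasisRight_tmul_one_mul,
      LinearEquiv.apply_symm_apply]
    exact ha j
  · intro h
    have := equivFinsuppOfBasisRight_map 𝒟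
      (IsScalarTower.toAlgHom k O (IsLocalRing.ResidueField O))
      ((equivFinsuppOfBasisRight 𝒟).symm g) i
    rw [h, LinearEquiv.apply_symm_apply, hgi] at this
    simp at this

/-- For a domain `D`, every unit of `K ⊗ D` is a scalar multiple of a unit of `O ⊗ D`. -/
lemma exists_tmul_one_mul_eq_map_unit [IsAlgClosed k] [IsDomain D] [Algebra.FiniteType k D]
    (u : (K ⊗[k] D)ˣ) : ∃ c : K, c ≠ 0 ∧ ∃ x : (O ⊗[k] D)ˣ,
      Algebra.TensorProduct.map (IsScalarTower.toAlgHom k O K) (AlgHom.id k D) (x : O ⊗[k] D) =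
        (c ⊗ₜ 1) * (u : K ⊗[k] D) := by
  set ι := Algebra.TensorProduct.map (IsScalarTower.toAlgHom k O K) (AlgHom.id k D) with hι
  have hinj : Function.Injective ι :=
    Module.Flat.rTensor_preserves_injective_linearMap (M := D)
      (IsScalarTower.toAlgHom k O K).toLinearMap (IsFractionRing.injective O K)
  obtain ⟨c, hc, x, hx, hx0⟩ := exists_primitive_multiple O u.ne_zero
  obtain ⟨d, hd, z, hz, hz0⟩ := exists_primitive_multiple O u⁻¹.ne_zero
  set ρ := Algebra.TensorProduct.map (IsScalarTower.toAlgHom k O (IsLocalRing.ResidueField O))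
        (AlgHom.id k D) with hρ
  have hxz : ι (x * z) = (c * d) ⊗ₜ 1 := by
    rw [map_mul, hx, hz, mul_mul_mul_comm, Units.mul_inv]
    simp
  obtain ⟨a, ha⟩ := mem_range_algebraMap_of_map_eq_tmul_one O hxz
  have hxza : x * z = a ⊗ₜ 1 := hinj (by rw [hxz, hι]; simp [ha])
  have hau : IsUnit a := by
    by_contra h
    have := noZeroDivisors_tensorProduct (k := k) (E := IsLocalRing.ResidueField O) (B := D)
    apply mul_ne_zero hx0 hz0
    rw [← map_mul, hxza, hρ, Algebra.TensorProduct.map_tmul]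
    have : IsScalarTower.toAlgHom k O (IsLocalRing.ResidueField O) a = 0 :=
      (IsLocalRing.residue_eq_zero_iff a).mpr ((IsLocalRing.mem_maximalIdeal a).mpr h)
    rw [this, zero_tmul]
  have hxu : IsUnit x := by
    apply isUnit_of_mul_isUnit_left (y := z)
    rw [hxza]
    exact hau.map (Algebra.TensorProduct.includeLeft : O →ₐ[k] O ⊗[k] D)
  exact ⟨c, hc, hxu.unit, hx⟩

end Normalize

section Connected

/-- A function on the spectrum of a Noetherian ring with connected spectrum that is compatible
with specialization is constant. -/
lemma PrimeSpectrum.eq_of_forall_le_eq {R T : Type*} [CommRing R] [IsNoetherianRing R]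
    [ConnectedSpace (PrimeSpectrum R)] (φ : PrimeSpectrum R → T)
    (h : ∀ p q, p ≤ q → φ p = φ q) (p q : PrimeSpectrum R) : φ p = φ q := by
  have hclosed (S : Set T) : IsClosed (φ ⁻¹' S) := by
    have hS : φ ⁻¹' S = ⋃ I ∈ {I ∈ minimalPrimes R | ∃ hI : I.IsPrime, φ ⟨I, hI⟩ ∈ S},
        PrimeSpectrum.zeroLocus (I : Set R) := by
      ext r
      simp only [Set.mem_preimage, Set.mem_iUnion, Set.mem_ofPred_eq, exists_prop,
        PrimeSpectrum.mem_zeroLocus, SetLike.coe_subset_coe]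
      constructor
      · intro hr
        obtain ⟨I, hI, hIr⟩ := Ideal.exists_minimalPrimes_le (bot_le : ⊥ ≤ r.asIdeal)
        refine ⟨I, ⟨hI, hI.1.1, ?_⟩, hIr⟩
        rwa [h ⟨I, hI.1.1⟩ r hIr]
      · rintro ⟨I, ⟨-, hI, hφ⟩, hIr⟩
        rwa [← h ⟨I, hI⟩ r hIr]
    rw [hS]
    exact ((minimalPrimes.finite_of_isNoetherianRing R).subset fun I hI ↦ hI.1).isClosed_biUnion
      fun I _ ↦ PrimeSpectrum.isClosed_zeroLocus _
  have hclopen : IsClopen (φ ⁻¹' {φ q}) :=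
    ⟨hclosed _, by rw [← isClosed_compl_iff, ← Set.preimage_compl]; exact hclosed _⟩
  have huniv := hclopen.eq_univ ⟨q, rfl⟩
  exact (huniv ▸ Set.mem_univ p : p ∈ φ ⁻¹' {φ q})

lemma PrimeSpectrum.connectedSpace_of_injective {R S : Type*} [CommRing R] [CommRing S]
    [ConnectedSpace (PrimeSpectrum S)] (f : R →+* S) (hf : Function.Injective f) :
    ConnectedSpace (PrimeSpectrum R) where
  toPreconnectedSpace := by
    refine DenseRange.preconnectedSpace (f := PrimeSpectrum.comap f) ?_ (by fun_prop)
    rw [PrimeSpectrum.denseRange_comap_iff_ker_le_nilRadical,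
      (RingHom.injective_iff_ker_eq_bot f).mp hf]
    exact bot_le
  toNonempty := ConnectedSpace.toNonempty.map (PrimeSpectrum.comap f)

end Connected

section Normalizer

variable {k K : Type*} (O : Type*) {B D C : Type*} [Field k] [CommRing O] [IsDomain O]
  [ValuationRing O] [Field K] [Algebra O K] [IsFractionRing O K] [Algebra k O] [Algebra k K]
  [IsScalarTower k O K] [CommRing B] [Algebra k B] [CommRing D] [Algebra k D] [CommRing C]
  [Algebra k C]

/-- The scalar `c` multiplies the image of `u` under `g` into the units of `O ⊗ D`. -/
def IsNormalizer (g : B →ₐ[k] D) (u : K ⊗[k] B) (c : K) : Prop :=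
  c ≠ 0 ∧ ∃ x : (O ⊗[k] D)ˣ,
    Algebra.TensorProduct.map (IsScalarTower.toAlgHom k O K) (AlgHom.id k D) (x : O ⊗[k] D) =
      (c ⊗ₜ 1) * Algebra.TensorProduct.map (AlgHom.id k K) g u

variable {O}

omit [IsDomain O] [ValuationRing O] [IsFractionRing O K] in
lemma IsNormalizer.comp {g : B →ₐ[k] D} {u : K ⊗[k] B} {c : K} (h : IsNormalizer O g u c)
    (f : D →ₐ[k] C) : IsNormalizer O (f.comp g) u c := by
  obtain ⟨hc, x, hx⟩ := h
  refine ⟨hc, Units.map (Algebra.TensorProduct.map (AlgHom.id k O) f).toMonoidHom x, ?_⟩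
  have h1 (z : O ⊗[k] D) :
      Algebra.TensorProduct.map (IsScalarTower.toAlgHom k O K) (AlgHom.id k C)
        (Algebra.TensorProduct.map (AlgHom.id k O) f z) =
      Algebra.TensorProduct.map (AlgHom.id k K) f
        (Algebra.TensorProduct.map (IsScalarTower.toAlgHom k O K) (AlgHom.id k D) z) := by
    induction z with
    | zero => simp
    | tmul e d => simp
    | add z z' hz hz' => simp only [map_add, hz, hz']
  have h2 (z : K ⊗[k] B) :
      Algebra.TensorProduct.map (AlgHom.id k K) f
        (Algebra.TensorProduct.map (AlgHom.id k K) g z) =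
      Algebra.TensorProduct.map (AlgHom.id k K) (f.comp g) z := by
    induction z with
    | zero => simp
    | tmul e d => simp
    | add z z' hz hz' => simp only [map_add, hz, hz']
  refine (h1 _).trans ?_
  rw [hx, map_mul, h2]
  simp

omit [IsDomain O] [ValuationRing O] [IsFractionRing O K] in
lemma IsNormalizer.exists_algebraMap_eq_div [Nontrivial D] {g : B →ₐ[k] D} {u : K ⊗[k] B}
    {c d : K} (hc : IsNormalizer O g u c) (hd : IsNormalizer O g u d) :
    ∃ a : O, algebraMap O K a = c / d := by
  obtain ⟨hc, x, hx⟩ := hc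
  obtain ⟨hd, z, hz⟩ := hd
  apply mem_range_algebraMap_of_map_eq_tmul_one (k := k) (D := D) O (x := x * ↑z⁻¹)
  have hcd : (c ⊗ₜ[k] 1 : K ⊗[k] D) = (c / d) ⊗ₜ 1 * d ⊗ₜ 1 := by simp [hd]
  rw [map_mul, hx, hcd, mul_assoc ((c / d) ⊗ₜ[k] (1 : D)), ← hz, mul_assoc, ← map_mul,
    Units.mul_inv, map_one, mul_one]

lemma IsNormalizer.valuation_eq [Nontrivial D] {g : B →ₐ[k] D} {u : K ⊗[k] B}
    {c d : K} (hc : IsNormalizer O g u c) (hd : IsNormalizer O g u d) :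
    ValuationRing.valuation O K c = ValuationRing.valuation O K d := by
  have key {c d : K} (hc : IsNormalizer O g u c) (hd : IsNormalizer O g u d) :
      ValuationRing.valuation O K c ≤ ValuationRing.valuation O K d := by
    have := (ValuationRing.mem_integer_iff O K _).mpr (hc.exists_algebraMap_eq_div hd)
    rwa [Valuation.mem_integer_iff, map_div₀, div_le_one₀] at this
    exact zero_lt_iff.mpr ((Valuation.ne_zero_iff _).mpr hd.1)
  exact le_antisymm (key hc hd) (key hd hc)

omit [IsDomain O] [ValuationRing O] [IsFractionRing O K] in
lemma isNormalizer_inv_evalRight (u : (K ⊗[k] B)ˣ) (y : B →ₐ[k] k) :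
    IsNormalizer O y (u : K ⊗[k] B) (evalRight K y u)⁻¹ := by
  have h0 : evalRight K y u ≠ 0 := (u.isUnit.map (evalRight K y)).ne_zero
  refine ⟨inv_ne_zero h0, 1, ?_⟩
  apply (Algebra.TensorProduct.rid k k K).injective
  rw [map_mul]
  change _ = _ * evalRight K y u
  simp [h0]

variable [IsAlgClosed k] [Algebra.FiniteType k B]

variable (O) in
lemma exists_isNormalizer (u : (K ⊗[k] B)ˣ) (q : PrimeSpectrum B) :
    ∃ c : K, IsNormalizer O (Ideal.Quotient.mkₐ k q.asIdeal) (u : K ⊗[k] B) c := by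
  have : Algebra.FiniteType k (B ⧸ q.asIdeal) :=
    Algebra.FiniteType.of_surjective (Ideal.Quotient.mkₐ k _) Ideal.Quotient.mk_surjective
  exact exists_tmul_one_mul_eq_map_unit O (Units.map
    (Algebra.TensorProduct.map (AlgHom.id k K) (Ideal.Quotient.mkₐ k q.asIdeal)).toMonoidHom u)

variable (O) in
lemma valuation_evalRight_eq [ConnectedSpace (PrimeSpectrum B)] (u : (K ⊗[k] B)ˣ)
    (y z : B →ₐ[k] k) :
    ValuationRing.valuation O K (evalRight K y u) =
      ValuationRing.valuation O K (evalRight K z u) := by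
  have : IsNoetherianRing B := Algebra.FiniteType.isNoetherianRing k B
  choose c hc using exists_isNormalizer O u
  have hle (p q : PrimeSpectrum B) (hpq : p ≤ q) :
      ValuationRing.valuation O K (c p) = ValuationRing.valuation O K (c q) :=
    ((hc p).comp (Ideal.Quotient.factorₐ k hpq)).valuation_eq (hc q)
  have hy (y : B →ₐ[k] k) :
      ValuationRing.valuation O K (c ⟨RingHom.ker y, RingHom.ker_isPrime y⟩) =
        (ValuationRing.valuation O K (evalRight K y u))⁻¹ := by
    rw [← map_inv₀]
    refine IsNormalizer.valuation_eq ?_ (isNormalizer_inv_evalRight u y)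
    have := (hc ⟨RingHom.ker y, RingHom.ker_isPrime y⟩).comp (Ideal.kerLiftAlg y)
    exact this
  rw [← inv_inj, ← hy, ← hy]
  exact PrimeSpectrum.eq_of_forall_le_eq _ hle _ _

end Normalizer

section Constant

variable {k : Type*} [Field k] [IsAlgClosed k]

/-- An element of an extension field of an algebraically closed field `k` lying in all valuation
subrings that contain `k` belongs to `k`. -/
lemma mem_range_algebraMap_of_forall_mem_valuationSubring {K : Type*} [Field K] [Algebra k K]
    {w : K} (h : ∀ V : ValuationSubring K, (∀ c : k, algebraMap k K c ∈ V) → w ∈ V) :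
    ∃ c : k, algebraMap k K c = w := by
  have hmem : w ∈ (⨅ V : {V : ValuationSubring K //
      Set.range (algebraMap k K) ⊆ V.toSubring}, V.val.toSubring) :=
    Subring.mem_iInf.mpr fun V ↦ h V.1 fun c ↦ V.2 ⟨c, rfl⟩
  rw [iInf_valuationSubring_superset] at hmem
  have hint : (algebraMap (Subring.closure (Set.range (algebraMap k K))) K).IsIntegralElem w :=
    hmem
  have hw : IsIntegral k w := by
    have hcl : Subring.closure (Set.range (algebraMap k K)) = (algebraMap k K).range := by
      rw [← RingHom.coe_range, Subring.closure_eq]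
    rw [hcl] at hint
    obtain ⟨p, hp, hpw⟩ := hint
    have hlift : p ∈ Polynomial.lifts (algebraMap k K).rangeRestrict := by
      rw [Polynomial.lifts_iff_coeff_lifts]
      exact fun n ↦ (algebraMap k K).rangeRestrict_surjective _
    obtain ⟨q, hq, -, hqm⟩ := Polynomial.lifts_and_degree_eq_and_monic hlift hp
    refine ⟨q, hqm, ?_⟩
    rw [← hq, Polynomial.eval₂_map] at hpw
    exact hpw
  exact (minpoly.mem_range_of_degree_eq_one k w
    (IsAlgClosed.degree_eq_one_of_irreducible k (minpoly.irreducible hw)))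

lemma exists_evalRight_eq_mul_of_field {K B : Type*} [Field K] [Algebra k K] [CommRing B]
    [Algebra k B] [Algebra.FiniteType k B] [ConnectedSpace (PrimeSpectrum B)] (u : (K ⊗[k] B)ˣ)
    (y z : B →ₐ[k] k) : ∃ c : k, algebraMap k K c = evalRight K y u / evalRight K z u := by
  refine mem_range_algebraMap_of_forall_mem_valuationSubring fun V hV ↦ ?_
  let : Algebra k V := ((algebraMap k K).codRestrict V.toSubring hV).toAlgebra
  have : IsScalarTower k V K := .of_algebraMap_eq fun _ ↦ rfl
  have hz : evalRight K z u ≠ 0 := (u.isUnit.map (evalRight K z)).ne_zero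
  have : evalRight K y u / evalRight K z u ∈ (ValuationRing.valuation V K).integer := by
    rw [Valuation.mem_integer_iff, map_div₀, valuation_evalRight_eq V u y z,
      div_self ((Valuation.ne_zero_iff _).mpr hz)]
  obtain ⟨a, ha⟩ := (ValuationRing.mem_integer_iff V K _).mp this
  rw [← ha]
  exact a.2

lemma exists_evalRight_eq_mul {A B : Type*} [CommRing A] [Algebra k A] [IsReduced A]
    [Algebra.FiniteType k A] [ConnectedSpace (PrimeSpectrum A)] [CommRing B]
    [Algebra k B] [Algebra.FiniteType k B] [ConnectedSpace (PrimeSpectrum B)] (u : (A ⊗[k] B)ˣ)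
    (y z : B →ₐ[k] k) : ∃ c : k, evalRight A y u = algebraMap k A c * evalRight A z u := by
  have : IsNoetherianRing A := Algebra.FiniteType.isNoetherianRing k A
  have hA : Nontrivial A := PrimeSpectrum.nonempty_iff_nontrivial.mp inferInstance
  have key (p : PrimeSpectrum A) :
      ∃ c : k, evalRight A y u - algebraMap k A c * evalRight A z u ∈ p.asIdeal := by
    let f := IsScalarTower.toAlgHom k A p.asIdeal.ResidueField
    obtain ⟨c, hc⟩ := exists_evalRight_eq_mul_of_field
      (Units.map (Algebra.TensorProduct.map f (AlgHom.id k B)).toMonoidHom u) y z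
    refine ⟨c, ?_⟩
    have hu (y : B →ₐ[k] k) : evalRight p.asIdeal.ResidueField y
        (Units.map (Algebra.TensorProduct.map f (AlgHom.id k B)).toMonoidHom u :
          (p.asIdeal.ResidueField ⊗[k] B)ˣ) = f (evalRight A y u) := evalRight_map f y u
    have hz : f (evalRight A z u) ≠ 0 := ((u.isUnit.map (evalRight A z)).map f).ne_zero
    rw [hu, hu, eq_div_iff hz] at hc
    rw [← Ideal.algebraMap_residueField_eq_zero]
    change f _ = 0
    rw [map_sub, map_mul, AlgHom.commutes, hc, sub_self]
  choose c hc using key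
  have hle (p q : PrimeSpectrum A) (hpq : p ≤ q) : c p = c q := by
    by_contra hne
    have hmem := sub_mem (hc q) (hpq (hc p))
    rw [sub_sub_sub_cancel_left, ← sub_mul, ← map_sub] at hmem
    have hunit : IsUnit (algebraMap k A (c p - c q) * evalRight A z u) :=
      ((sub_ne_zero.mpr hne).isUnit.map (algebraMap k A)).mul (u.isUnit.map (evalRight A z))
    exact q.2.ne_top (Ideal.eq_top_of_isUnit_mem _ hmem hunit)
  obtain ⟨p⟩ : Nonempty (PrimeSpectrum A) := inferInstance
  refine ⟨c p, ?_⟩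
  rw [← sub_eq_zero, ← isNilpotent_iff_eq_zero, ← mem_nilradical, nilradical_eq_sInf,
    Ideal.mem_sInf]
  intro I hI
  have := hc ⟨I, hI⟩
  rwa [PrimeSpectrum.eq_of_forall_le_eq c hle ⟨I, hI⟩ p] at this

end Constant

section Units

variable {k : Type*} [Field k] [IsAlgClosed k] {A B : Type*} [CommRing A] [Algebra k A]
  [CommRing B] [Algebra k B]

lemma exists_unit_tmul_unit_of_finiteType [IsReduced A] [IsReduced B] [Algebra.FiniteType k A]
    [Algebra.FiniteType k B] [ConnectedSpace (PrimeSpectrum A)]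
    [ConnectedSpace (PrimeSpectrum B)] (u : (A ⊗[k] B)ˣ) :
    ∃ (a : Aˣ) (b : Bˣ), (u : A ⊗[k] B) = (a : A) ⊗ₜ[k] (b : B) := by
  have hA : Nontrivial A := PrimeSpectrum.nonempty_iff_nontrivial.mp inferInstance
  have hB : Nontrivial B := PrimeSpectrum.nonempty_iff_nontrivial.mp inferInstance
  obtain ⟨x₀⟩ := exists_algHom_of_nontrivial k A
  obtain ⟨y₀⟩ := exists_algHom_of_nontrivial k B
  let a : Aˣ := Units.map (evalRight A y₀).toMonoidHom u
  let ε : A ⊗[k] B →ₐ[k] B := (Algebra.TensorProduct.lid k B).toAlgHom.comp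
    (Algebra.TensorProduct.map x₀ (AlgHom.id k B))
  let v : (A ⊗[k] B)ˣ :=
    Units.map (Algebra.TensorProduct.includeLeft : A →ₐ[k] A ⊗[k] B).toMonoidHom a⁻¹ * u
  let b : Bˣ := Units.map ε.toMonoidHom v
  have hε (y : B →ₐ[k] k) (w : A ⊗[k] B) : y (ε w) = x₀ (evalRight A y w) := by
    induction w with
    | zero => simp
    | tmul e d => simp [ε, mul_comm]
    | add w w' hw hw' => simp only [map_add, hw, hw']
  have hv : (v : A ⊗[k] B) = (↑a⁻¹ : A) ⊗ₜ 1 * (u : A ⊗[k] B) := rfl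
  have hvb : (v : A ⊗[k] B) = 1 ⊗ₜ (b : B) := by
    rw [← sub_eq_zero]
    refine eq_zero_of_forall_evalRight_eq_zero fun y ↦ ?_
    obtain ⟨c, hc⟩ := exists_evalRight_eq_mul u y y₀
    have hva : evalRight A y v = algebraMap k A c := by
      have ha : evalRight A y₀ u = a := rfl
      rw [hv, map_mul, hc, ha, evalRight_tmul, map_one, one_smul, mul_left_comm, Units.inv_mul,
        mul_one]
    have hb : y b = c := by
      refine (hε y v).trans ?_
      rw [hva, AlgHom.commutes]
      rfl
    rw [map_sub, hva, evalRight_tmul, hb, Algebra.algebraMap_eq_smul_one, sub_self]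
  refine ⟨a, b, ?_⟩
  calc (u : A ⊗[k] B) = (a : A) ⊗ₜ 1 * (v : A ⊗[k] B) := by
        rw [hv, ← mul_assoc, Algebra.TensorProduct.tmul_mul_tmul, Units.mul_inv, mul_one,
          ← Algebra.TensorProduct.one_def, one_mul]
    _ = _ := by rw [hvb]; simp

omit [IsAlgClosed k] in
/-- Every unit of a tensor product is defined over finitely generated subalgebras. -/
lemma exists_fg_subalgebra_unit (u : (A ⊗[k] B)ˣ) :
    ∃ (A₀ : Subalgebra k A) (B₀ : Subalgebra k B), A₀.FG ∧ B₀.FG ∧ ∃ w : (A₀ ⊗[k] B₀)ˣ,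
      Algebra.TensorProduct.map A₀.val B₀.val (w : A₀ ⊗[k] B₀) = u := by
  obtain ⟨M, N, hM, hN, h⟩ := exists_finite_submodule_of_setFinite
    {(u : A ⊗[k] B), (↑u⁻¹ : A ⊗[k] B)} (Set.toFinite _)
  let A₀ := Algebra.adjoin k (M : Set A)
  let B₀ := Algebra.adjoin k (N : Set B)
  let ι := Algebra.TensorProduct.map A₀.val B₀.val
  have hinj : Function.Injective ι :=
    map_injective_of_flat_flat A₀.val.toLinearMap B₀.val.toLinearMap
      Subtype.val_injective Subtype.val_injective
  have hrange {t : A ⊗[k] B} (ht : t ∈ LinearMap.range (mapIncl M N)) : ∃ w, ι w = t := by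
    obtain ⟨s, rfl⟩ := ht
    induction s with
    | zero => exact ⟨0, by simp⟩
    | tmul m n =>
      exact ⟨(⟨m, Algebra.subset_adjoin m.2⟩ : A₀) ⊗ₜ (⟨n, Algebra.subset_adjoin n.2⟩ : B₀),
        by simp [ι, mapIncl]⟩
    | add s s' hs hs' =>
      obtain ⟨w, hw⟩ := hs
      obtain ⟨w', hw'⟩ := hs'
      exact ⟨w + w', by rw [map_add, map_add, hw, hw']⟩
  obtain ⟨w, hw⟩ := hrange (h (Set.mem_insert _ _))
  obtain ⟨w', hw'⟩ := hrange (h (Set.mem_insert_of_mem _ rfl))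
  have hww' : w * w' = 1 := hinj (by rw [map_mul, hw, hw', Units.mul_inv, map_one])
  refine ⟨A₀, B₀, ?_, ?_, ⟨w, w', hww', by rw [mul_comm, hww']⟩, hw⟩
  · obtain ⟨s, hs⟩ := Module.Finite.iff_fg.mp hM
    exact ⟨s, by rw [← Algebra.adjoin_span, hs]⟩
  · obtain ⟨s, hs⟩ := Module.Finite.iff_fg.mp hN
    exact ⟨s, by rw [← Algebra.adjoin_span, hs]⟩

end Units

/-- over an algebraically closed field `k`, every unit of a tensor
product `A ⊗_k B` of reduced `k`-algebras with connected spectra is of the form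
`a ⊗ b` with `a ∈ A^×`, `b ∈ B^×`. -/
theorem units_of_tensor_product {k : Type u} [Field k] [IsAlgClosed k]
    (A B : Type u) [CommRing A] [Algebra k A] [CommRing B] [Algebra k B]
    [IsReduced A] [IsReduced B]
    [ConnectedSpace (PrimeSpectrum A)] [ConnectedSpace (PrimeSpectrum B)]
    (u : (A ⊗[k] B)ˣ) :
    ∃ (a : Aˣ) (b : Bˣ), (u : A ⊗[k] B) = (a : A) ⊗ₜ[k] (b : B) := by
  obtain ⟨A₀, B₀, hA, hB, w, hw⟩ := exists_fg_subalgebra_unit u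
  have := A₀.fg_iff_finiteType.mp hA
  have := B₀.fg_iff_finiteType.mp hB
  have := PrimeSpectrum.connectedSpace_of_injective A₀.val.toRingHom Subtype.val_injective
  have := PrimeSpectrum.connectedSpace_of_injective B₀.val.toRingHom Subtype.val_injective
  have : IsReduced A₀ := isReduced_of_injective A₀.val Subtype.val_injective
  have : IsReduced B₀ := isReduced_of_injective B₀.val Subtype.val_injective
  obtain ⟨a, b, hab⟩ := exists_unit_tmul_unit_of_finiteType w
  refine ⟨Units.map A₀.val.toMonoidHom a, Units.map B₀.val.toMonoidHom b, ?_⟩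
  rw [← hw, hab]
  rfl
end

section
/- Let k be an algebraically closed field, A a reduced commutative k-algebra with connected prime spectrum, and 𝔪 ⊂ A a maximal ideal with A/𝔪 = k. Let B be a commutative k-algebra with only finitely many idempotent elements, and write B = B_1 × ⋯ × B_n where each B_i has connected prime spectrum. Then, under the induced identification A ⊗_k B ≅ (A ⊗_k B_1) × ⋯ × (A ⊗_k B_n), every unit of A ⊗_k B is of the form (u_1, …, u_n) where each u_i = (a_i ⊗ 1)(1 ⊗ b_i)·v_i with a_i ∈ A^×, b_i ∈ B_i^×, and v_i ∈ 1 + 𝔪 ⊗ Nil(B_i); moreover for each i this expression is unique, i.e. (A ⊗_k B_i)^× is the internal direct sum of A^×B_i^× and 1 + 𝔪 ⊗ Nil(B_i). -/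
universe u

open TensorProduct

variable (k : Type u) [Field k]

/-- The subset `A^× B^× = {(a ⊗ 1)(1 ⊗ b) : a ∈ A^×, b ∈ B^×}` of `A ⊗_k B`. -/
def unitsS1 (A B : Type u) [CommRing A] [Algebra k A] [CommRing B] [Algebra k B] :
    Set (A ⊗[k] B) :=
  { w | ∃ (a : Aˣ) (b : Bˣ), w = (a : A) ⊗ₜ[k] (b : B) }

/-- The subset `1 + 𝔪 ⊗ Nil(B)` of `A ⊗_k B`: elements `1 + x` with `x` in the
image of the natural map `𝔪 ⊗_k Nil(B) → A ⊗_k B`. -/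
def unitsS2 (A B : Type u) [CommRing A] [Algebra k A] [CommRing B] [Algebra k B]
    (𝔪 : Ideal A) : Set (A ⊗[k] B) :=
  { w | ∃ x ∈ LinearMap.range (TensorProduct.map
      (Submodule.restrictScalars k 𝔪).subtype
      (Submodule.restrictScalars k (nilradical B)).subtype), w = 1 + x }

/-- `(A ⊗_k B)ˣ` is the internal direct sum of the subgroups `A^× B^×` and
`1 + 𝔪 ⊗ Nil(B)`: every unit is a product of an element of each, in a unique way. -/
def IsUnitsDirectSum (A B : Type u) [CommRing A] [Algebra k A] [CommRing B]
    [Algebra k B] (𝔪 : Ideal A) : Prop :=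
  (∀ u : (A ⊗[k] B)ˣ, ∃ s ∈ unitsS1 k A B, ∃ t ∈ unitsS2 k A B 𝔪,
      (u : A ⊗[k] B) = s * t) ∧
  ∀ s ∈ unitsS1 k A B, ∀ s' ∈ unitsS1 k A B, ∀ t ∈ unitsS2 k A B 𝔪,
    ∀ t' ∈ unitsS2 k A B 𝔪, s * t = s' * t' → s = s' ∧ t = t'

section Points

variable {k}

/-- The base change `A ⊗ R → R` of a `k`-point `A → k`. -/
noncomputable def evalAt {A : Type*} [CommRing A] [Algebra k A] (x : A →ₐ[k] k)
    (R : Type*) [CommRing R] [Algebra k R] : A ⊗[k] R →ₐ[k] R :=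
  (Algebra.TensorProduct.lid k R).toAlgHom.comp
    (Algebra.TensorProduct.map x (AlgHom.id k R))

variable {A : Type*} [CommRing A] [Algebra k A]
  {R : Type*} [CommRing R] [Algebra k R] {S : Type*} [CommRing S] [Algebra k S]

@[simp]
lemma evalAt_tmul (x : A →ₐ[k] k) (a : A) (r : R) : evalAt x R (a ⊗ₜ r) = x a • r := by
  simp [evalAt]

lemma evalAt_map_right (x : A →ₐ[k] k) (f : R →ₐ[k] S) (t : A ⊗[k] R) :
    evalAt x S (Algebra.TensorProduct.map (AlgHom.id k A) f t) = f (evalAt x R t) := by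
  induction t with
  | zero => simp
  | tmul a r => simp
  | add s t hs ht => simp only [map_add, hs, ht]

lemma evalAt_map_left {A' : Type*} [CommRing A'] [Algebra k A'] (x : A' →ₐ[k] k)
    (f : A →ₐ[k] A') (t : A ⊗[k] R) :
    evalAt x R (Algebra.TensorProduct.map f (AlgHom.id k R) t) = evalAt (x.comp f) R t := by
  induction t with
  | zero => simp
  | tmul a r => simp
  | add s t hs ht => simp only [map_add, hs, ht]

lemma repr_evalAt {ι : Type*} [DecidableEq ι] (b : Module.Basis ι k R) (x : A →ₐ[k] k)
    (t : A ⊗[k] R) (i : ι) :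
    b.repr (evalAt x R t) i = x (TensorProduct.equivFinsuppOfBasisRight b t i) := by
  induction t with
  | zero => simp
  | tmul a r => simp [mul_comm]
  | add s t hs ht => simp only [map_add, Finsupp.add_apply, hs, ht]

lemma exists_point_of_isMaximal (M : Ideal A) [M.IsMaximal]
    (h : ∀ a : A, ∃ c : k, a - algebraMap k A c ∈ M) :
    ∃ x : A →ₐ[k] k, ∀ a, x a = 0 ↔ a ∈ M := by
  have hb : Function.Bijective (algebraMap k (A ⧸ M)) := by
    refine ⟨(algebraMap k (A ⧸ M)).injective, fun y ↦ ?_⟩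
    obtain ⟨a, rfl⟩ := Ideal.Quotient.mk_surjective y
    obtain ⟨c, hc⟩ := h a
    exact ⟨c, ((Ideal.Quotient.mk_eq_mk_iff_sub_mem _ _).2 hc).symm⟩
  let e : k ≃ₐ[k] A ⧸ M := AlgEquiv.ofBijective (Algebra.ofId k (A ⧸ M)) hb
  refine ⟨e.symm.toAlgHom.comp (Ideal.Quotient.mkₐ k M), fun a ↦ ?_⟩
  simp [Ideal.Quotient.eq_zero_iff_mem]

variable [IsAlgClosed k]

lemma exists_point_of_notMem [Algebra.FiniteType k A] (p : Ideal A) [p.IsPrime] {a : A}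
    (ha : a ∉ p) : ∃ x : A →ₐ[k] k, (∀ b ∈ p, x b = 0) ∧ x a ≠ 0 := by
  have : IsJacobsonRing A := isJacobsonRing_of_finiteType (A := k)
  have hj : p.jacobson = p := IsJacobsonRing.out' p (Ideal.IsPrime.isRadical ‹_›)
  rw [← hj, Ideal.jacobson, Ideal.mem_sInf] at ha
  push Not at ha
  obtain ⟨M, ⟨hpM, hM⟩, haM⟩ := ha
  let := Ideal.Quotient.field M
  have : Module.Finite k (A ⧸ M) := finite_of_finite_type_of_isJacobsonRing k (A ⧸ M)
  obtain ⟨x, hx⟩ := exists_point_of_isMaximal (k := k) M fun a ↦ by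
    obtain ⟨c, hc⟩ := (IsAlgClosed.algebraMap_bijective_of_isIntegral
      (k := k) (K := A ⧸ M)).2 (Ideal.Quotient.mk M a)
    exact ⟨c, (Ideal.Quotient.mk_eq_mk_iff_sub_mem _ _).1 hc.symm⟩
  exact ⟨x, fun b hb ↦ (hx b).2 (hpM hb), fun h ↦ haM ((hx a).1 h)⟩

lemma eq_zero_of_forall_evalAt_eq_zero [Algebra.FiniteType k A] [IsReduced A] {t : A ⊗[k] R}
    (h : ∀ x : A →ₐ[k] k, evalAt x R t = 0) : t = 0 := by
  classical
  let b := Module.Basis.ofVectorSpace k R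
  apply (TensorProduct.equivFinsuppOfBasisRight b).injective
  ext i
  rw [map_zero, Finsupp.zero_apply]
  have hnil : TensorProduct.equivFinsuppOfBasisRight b t i ∈ nilradical A := by
    rw [nilradical_eq_sInf, Ideal.mem_sInf]
    intro p (hp : p.IsPrime)
    by_contra hn
    obtain ⟨x, -, hx⟩ := exists_point_of_notMem (k := k) p hn
    exact hx (by rw [← repr_evalAt, h, map_zero, Finsupp.zero_apply])
  simpa [nilradical_eq_zero] using hnil

lemma exists_evalAt_ne_zero [Algebra.FiniteType k A] [IsDomain A] {f : A ⊗[k] R} {g : A ⊗[k] S}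
    (hf : f ≠ 0) (hg : g ≠ 0) :
    ∃ x : A →ₐ[k] k, evalAt x R f ≠ 0 ∧ evalAt x S g ≠ 0 := by
  classical
  let b := Module.Basis.ofVectorSpace k R
  let c := Module.Basis.ofVectorSpace k S
  obtain ⟨i, hi⟩ := DFunLike.ne_iff.1
    ((TensorProduct.equivFinsuppOfBasisRight (M := A) b).map_ne_zero_iff.2 hf)
  obtain ⟨j, hj⟩ := DFunLike.ne_iff.1
    ((TensorProduct.equivFinsuppOfBasisRight (M := A) c).map_ne_zero_iff.2 hg)
  obtain ⟨x, -, hx⟩ := exists_point_of_notMem (k := k) (⊥ : Ideal A) (mul_ne_zero hi hj)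
  rw [map_mul, ← repr_evalAt, ← repr_evalAt] at hx
  refine ⟨x, fun h ↦ ?_, fun h ↦ ?_⟩ <;> simp [h] at hx

end Points

section Valuation

variable {k} {A : Type*} [CommRing A] [Algebra k A] {K : Type*} [Field K] [Algebra k K]

lemma exists_eq_mul_map_of_ne_zero (V : ValuationSubring K) [Algebra k V] [IsScalarTower k V K]
    {u : A ⊗[k] K} (hu : u ≠ 0) :
    ∃ (b : K) (u' : A ⊗[k] V), b ≠ 0 ∧
      u = (1 ⊗ₜ b) * Algebra.TensorProduct.map (AlgHom.id k A) (IsScalarTower.toAlgHom k V K) u' ∧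
      Algebra.TensorProduct.map (AlgHom.id k A)
        (IsScalarTower.toAlgHom k V (IsLocalRing.ResidueField V)) u' ≠ 0 := by
  classical
  let e := Module.Basis.ofVectorSpace k A
  let E := TensorProduct.equivFinsuppOfBasisLeft (N := K) e
  have hc : (E u).support.Nonempty := by
    rwa [Finsupp.support_nonempty_iff, E.map_ne_zero_iff]
  obtain ⟨m, hm, hmax⟩ := Finset.exists_max_image (E u).support (fun i ↦ V.valuation (E u i)) hc
  have hm0 : E u m ≠ 0 := Finsupp.mem_support_iff.1 hm
  have ho : ∀ i, ∃ o : V, (o : K) * E u m = E u i := fun i ↦ by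
    rw [← V.valuation_le_iff]
    by_cases hi : i ∈ (E u).support
    · exact hmax i hi
    · simp [Finsupp.notMem_support_iff.1 hi]
  choose o ho using ho
  have hom : o m = 1 := Subtype.ext (mul_right_cancel₀ hm0 (by simpa using ho m))
  refine ⟨E u m, ∑ i ∈ (E u).support, e i ⊗ₜ o i, hm0, ?_, fun h ↦ ?_⟩
  · conv_lhs => rw [← E.symm_apply_apply u]
    rw [TensorProduct.equivFinsuppOfBasisLeft_symm_apply, Finsupp.sum, map_sum, Finset.mul_sum]
    refine Finset.sum_congr rfl fun i _ ↦ ?_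
    rw [← ho i]
    simp [mul_comm]
  · have := DFunLike.congr_fun (congrArg (TensorProduct.equivFinsuppOfBasisLeft e) h) m
    simp [Finsupp.single_apply, hom, hm0] at this

variable [IsAlgClosed k]

lemma evalAt_mul_evalAt_mem [Algebra.FiniteType k A] [IsDomain A] (V : ValuationSubring K)
    (hV : ∀ c : k, algebraMap k K c ∈ V) {u w : A ⊗[k] K} (huw : u * w = 1) (x y : A →ₐ[k] k) :
    evalAt x K u * evalAt y K w ∈ V := by
  let : Algebra k V := ((algebraMap k K).codRestrict V.toSubring hV).toAlgebra
  have : IsScalarTower k V K := .of_algebraMap_eq fun _ ↦ rfl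
  obtain ⟨b, u', hb, rfl, hu'⟩ := exists_eq_mul_map_of_ne_zero V (left_ne_zero_of_mul_eq_one huw)
  obtain ⟨d, w', hd, rfl, hw'⟩ := exists_eq_mul_map_of_ne_zero V (right_ne_zero_of_mul_eq_one huw)
  obtain ⟨z, hzu, hzw⟩ := exists_evalAt_ne_zero hu' hw'
  rw [evalAt_map_right] at hzu hzw
  have key (x : A →ₐ[k] k) : b * evalAt x V u' * (d * evalAt x V w') = 1 := by
    have := congrArg (evalAt x K) huw
    simpa only [map_mul, map_one, evalAt_map_right, evalAt_tmul, one_smul,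
      IsScalarTower.coe_toAlgHom', ValuationSubring.algebraMap_apply] using this
  have hunit : IsUnit (evalAt z V u' * evalAt z V w') :=
    ((IsLocalRing.residue_ne_zero_iff_isUnit _).1 hzu).mul
      ((IsLocalRing.residue_ne_zero_iff_isUnit _).1 hzw)
  have hbd : b * d ∈ V := by
    obtain ⟨c, hc⟩ := hunit.exists_left_inv
    have hc' : (c : K) * (evalAt z V u' * evalAt z V w') = 1 := congrArg Subtype.val hc
    have : b * d = c := by linear_combination (c : K) * key z - b * d * hc'
    exact this ▸ c.2
  simp only [map_mul, evalAt_map_right, evalAt_tmul, map_one, one_smul,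
    IsScalarTower.coe_toAlgHom', ValuationSubring.algebraMap_apply]
  have := V.mul_mem _ _ hbd (evalAt x V u' * evalAt y V w').2
  convert this using 1
  simp
  ring

lemma exists_evalAt_eq_smul_of_isDomain [Algebra.FiniteType k A] [IsDomain A] {u w : A ⊗[k] K}
    (huw : u * w = 1) (x y : A →ₐ[k] k) :
    ∃ c : k, evalAt x K u = c • evalAt y K u := by
  have hy : evalAt y K u * evalAt y K w = 1 := by rw [← map_mul, huw, map_one]
  suffices h : IsIntegral k (evalAt x K u * evalAt y K w) by
    let L := Algebra.adjoin k {evalAt x K u * evalAt y K w}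
    have : Algebra.IsIntegral k L := Algebra.IsIntegral.adjoin (by simpa using h)
    obtain ⟨c, hc⟩ := (IsAlgClosed.algebraMap_bijective_of_isIntegral (k := k) (K := L)).2
      ⟨_, Algebra.self_mem_adjoin_singleton k _⟩
    have hc' : algebraMap k K c = evalAt x K u * evalAt y K w := congrArg Subtype.val hc
    exact ⟨c, by rw [Algebra.smul_def, hc']; linear_combination (-evalAt x K u) * hy⟩
  have h : evalAt x K u * evalAt y K w ∈
      (integralClosure (Subring.closure (Set.range (algebraMap k K))) K).toSubring := by
    rw [← iInf_valuationSubring_superset, Subring.mem_iInf]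
    exact fun V ↦ evalAt_mul_evalAt_mem V.1 (fun c ↦ V.2 ⟨c, rfl⟩) huw x y
  have hcl : Subring.closure (Set.range (algebraMap k K)) = (algebraMap k K).range := by
    rw [← RingHom.coe_range, Subring.closure_eq]
  rw [hcl] at h
  let : Algebra k (algebraMap k K).range := (algebraMap k K).rangeRestrict.toAlgebra
  have : IsScalarTower k (algebraMap k K).range K := .of_algebraMap_eq fun _ ↦ rfl
  have : Algebra.IsIntegral k (algebraMap k K).range :=
    ⟨RingHom.isIntegral_of_surjective _ (algebraMap k K).rangeRestrict_surjective⟩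
  exact isIntegral_trans _ h

end Valuation

section Connected

lemma connectedSpace_primeSpectrum_of_injective {R S : Type*} [CommRing R] [CommRing S]
    [ConnectedSpace (PrimeSpectrum S)] (f : R →+* S) (hf : Function.Injective f) :
    ConnectedSpace (PrimeSpectrum R) := by
  have hd : DenseRange (PrimeSpectrum.comap f) := by
    rw [PrimeSpectrum.denseRange_comap_iff_ker_le_nilRadical,
      (RingHom.injective_iff_ker_eq_bot f).1 hf]
    exact bot_le
  have := hd.preconnectedSpace (PrimeSpectrum.continuous_comap f)
  exact { toNonempty := .map (PrimeSpectrum.comap f) inferInstance }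

variable {k} {A : Type*} [CommRing A] [Algebra k A] {K : Type*} [Field K] [Algebra k K]
  {B : Type*} [CommRing B] [Algebra k B]

lemma exists_isNilpotent_sub_algebraMap [IsAlgClosed k] [ConnectedSpace (PrimeSpectrum B)] (b : B)
    (h : ∀ q : Ideal B, q.IsPrime → ∃ c : k, b - algebraMap k B c ∈ q) :
    ∃ c : k, IsNilpotent (b - algebraMap k B c) := by
  classical
  obtain ⟨f, hf0, hf⟩ : ∃ f : Polynomial k, f ≠ 0 ∧ Polynomial.aeval b f = 0 := by
    by_contra! hn
    let S : Submonoid B := (nonZeroDivisors (Polynomial k)).map (Polynomial.aeval b)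
    have hS : Disjoint ((⊥ : Ideal B) : Set B) S := by
      rw [Set.disjoint_left]
      rintro _ rfl ⟨f, hf, hfb⟩
      exact hn f (nonZeroDivisors.ne_zero hf) hfb
    obtain ⟨q, hq, -, hqS⟩ := Ideal.exists_le_prime_disjoint _ S hS
    obtain ⟨c, hc⟩ := h q hq
    refine Set.disjoint_left.1 hqS hc ⟨Polynomial.X - Polynomial.C c, ?_, by simp⟩
    exact mem_nonZeroDivisors_of_ne_zero (Polynomial.X_sub_C_ne_zero c)
  have hroot (q : Ideal B) (hq : q.IsPrime) (c : k) (hc : b - algebraMap k B c ∈ q) :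
      c ∈ f.roots.toFinset := by
    rw [Multiset.mem_toFinset, Polynomial.mem_roots hf0, Polynomial.IsRoot]
    by_contra hfc
    have hdvd := map_dvd (Polynomial.aeval b) (Polynomial.X_sub_C_dvd_sub_C_eval (a := c) (p := f))
    simp only [map_sub, Polynomial.aeval_X, Polynomial.aeval_C, hf, zero_sub, dvd_neg] at hdvd
    exact hq.ne_top (Ideal.eq_top_of_isUnit_mem _ (q.mem_of_dvd hdvd hc)
      ((isUnit_iff_ne_zero.2 hfc).map _))
  let Z (c : k) : Set (PrimeSpectrum B) := PrimeSpectrum.zeroLocus {b - algebraMap k B c}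
  have hZ (c : k) : IsClosed (Z c) := PrimeSpectrum.isClosed_zeroLocus _
  have hmem (c : k) (q : PrimeSpectrum B) : q ∈ Z c ↔ b - algebraMap k B c ∈ q.asIdeal := by
    simp [Z, PrimeSpectrum.mem_zeroLocus]
  obtain ⟨q₀⟩ : Nonempty (PrimeSpectrum B) := inferInstance
  obtain ⟨c₀, hc₀⟩ := h q₀.asIdeal q₀.isPrime
  have hcompl : (Z c₀)ᶜ = ⋃ c ∈ f.roots.toFinset.erase c₀, Z c := by
    ext q
    simp only [Set.mem_compl_iff, Set.mem_iUnion, hmem, exists_prop]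
    constructor
    · intro hq
      obtain ⟨c, hc⟩ := h q.asIdeal q.isPrime
      exact ⟨c, Finset.mem_erase.2 ⟨fun e ↦ hq (e ▸ hc), hroot _ q.isPrime c hc⟩, hc⟩
    · rintro ⟨c, hc, hcq⟩ hq
      have h2 := q.asIdeal.sub_mem hq hcq
      rw [sub_sub_sub_cancel_left, ← map_sub] at h2
      refine q.isPrime.ne_top (Ideal.eq_top_of_isUnit_mem _ h2 (IsUnit.map _ ?_))
      exact (sub_ne_zero.2 (Finset.ne_of_mem_erase hc)).isUnit
  have hclopen : IsClopen (Z c₀) := by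
    refine ⟨hZ c₀, ?_⟩
    rw [← isClosed_compl_iff, hcompl]
    exact isClosed_biUnion_finset fun c _ ↦ hZ c
  have huniv := hclopen.eq_univ ⟨q₀, (hmem _ _).2 hc₀⟩
  refine ⟨c₀, ?_⟩
  rw [← mem_nilradical, nilradical_eq_sInf, Ideal.mem_sInf]
  intro q (hq : q.IsPrime)
  exact (hmem c₀ ⟨q, hq⟩).1 (huniv ▸ Set.mem_univ _)

variable [IsAlgClosed k]

/-- On a connected affine variety, a property of points which is constant on each irreducible
closed subset is constant. -/
lemma forall_point_of_connectedSpace [Algebra.FiniteType k A] [ConnectedSpace (PrimeSpectrum A)]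
    (r : (A →ₐ[k] k) → Prop)
    (hr : ∀ p : Ideal A, p.IsPrime → ∀ x y : A →ₐ[k] k, p ≤ RingHom.ker x → p ≤ RingHom.ker y →
      r x → r y) {y : A →ₐ[k] k} (hy : r y) (x : A →ₐ[k] k) : r x := by
  have : IsNoetherianRing A := Algebra.FiniteType.isNoetherianRing k A
  let Z (I : Set (Ideal A)) : Set (PrimeSpectrum A) :=
    ⋃ p ∈ minimalPrimes A ∩ I, PrimeSpectrum.zeroLocus p
  have hZ (I) : IsClosed (Z I) :=
    ((minimalPrimes.finite_of_isNoetherianRing A).inter_of_left I).isClosed_biUnion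
      fun p _ ↦ PrimeSpectrum.isClosed_zeroLocus _
  let I : Set (Ideal A) := {p | ∃ x : A →ₐ[k] k, p ≤ RingHom.ker x ∧ r x}
  have hcompl : (Z I)ᶜ = Z Iᶜ := by
    ext P
    simp only [Z, Set.mem_compl_iff, Set.mem_iUnion, exists_prop, PrimeSpectrum.mem_zeroLocus,
      SetLike.coe_subset_coe, not_exists, not_and, Set.mem_inter_iff]
    constructor
    · intro hP
      obtain ⟨p, hp, hpP⟩ := Ideal.exists_minimalPrimes_le (I := ⊥) (J := P.asIdeal) bot_le
      exact ⟨p, ⟨hp, fun hI ↦ hP p ⟨hp, hI⟩ hpP⟩, hpP⟩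
    · rintro ⟨p, ⟨hp, hpI⟩, hpP⟩ p' ⟨hp', x, hpx, hx⟩ hp'P
      have hP1 : (1 : A) ∉ P.asIdeal := fun h ↦ P.isPrime.ne_top ((Ideal.eq_top_iff_one _).2 h)
      obtain ⟨z, hz, -⟩ := exists_point_of_notMem (k := k) P.asIdeal hP1
      have hz' : P.asIdeal ≤ RingHom.ker z := hz
      exact hpI ⟨z, hpP.trans hz', hr p' hp'.1.1 x z hpx (hp'P.trans hz') hx⟩
  have hclopen : IsClopen (Z I) := ⟨hZ I, by rw [← isClosed_compl_iff, hcompl]; exact hZ _⟩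
  have hker (x : A →ₐ[k] k) : (RingHom.ker x).IsPrime := RingHom.ker_isPrime x
  have hmem (x : A →ₐ[k] k) : ⟨RingHom.ker x, hker x⟩ ∈ Z I ↔ r x := by
    simp only [Z, Set.mem_iUnion, exists_prop, PrimeSpectrum.mem_zeroLocus,
      SetLike.coe_subset_coe, Set.mem_inter_iff]
    constructor
    · rintro ⟨p, ⟨hp, z, hpz, hz⟩, hpx⟩
      exact hr p hp.1.1 z x hpz hpx hz
    · intro hx
      obtain ⟨p, hp, hpx⟩ := Ideal.exists_minimalPrimes_le (I := ⊥) (J := RingHom.ker x) bot_le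
      exact ⟨p, ⟨hp, x, hpx, hx⟩, hpx⟩
  rw [← hmem, hclopen.eq_univ ⟨_, (hmem y).2 hy⟩]
  trivial

lemma exists_evalAt_eq_smul [Algebra.FiniteType k A] [ConnectedSpace (PrimeSpectrum A)]
    {u w : A ⊗[k] K} (huw : u * w = 1) (x y : A →ₐ[k] k) :
    ∃ c : k, evalAt x K u = c • evalAt y K u := by
  refine forall_point_of_connectedSpace (fun x ↦ ∃ c : k, evalAt x K u = c • evalAt y K u)
    (fun p hp z z' hz hz' ⟨c, hc⟩ ↦ ?_) (y := y) ⟨1, (one_smul _ _).symm⟩ x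
  replace hz : ∀ a ∈ p, z a = 0 := hz
  replace hz' : ∀ a ∈ p, z' a = 0 := hz'
  let φ := Algebra.TensorProduct.map (Ideal.Quotient.mkₐ k p) (AlgHom.id k K)
  have hφ : φ u * φ w = 1 := by rw [← map_mul, huw, map_one]
  obtain ⟨d, hd⟩ := exists_evalAt_eq_smul_of_isDomain hφ
    (Ideal.Quotient.liftₐ p z' hz') (Ideal.Quotient.liftₐ p z hz)
  rw [evalAt_map_left, evalAt_map_left, Ideal.Quotient.liftₐ_comp, Ideal.Quotient.liftₐ_comp,
    hc, smul_smul] at hd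
  exact ⟨_, hd⟩

lemma exists_isNilpotent_evalAt_sub [Algebra.FiniteType k A] [ConnectedSpace (PrimeSpectrum A)]
    [ConnectedSpace (PrimeSpectrum B)] {u w : A ⊗[k] B} (huw : u * w = 1) (x y : A →ₐ[k] k) :
    ∃ c : k, IsNilpotent (evalAt x B u * evalAt y B w - algebraMap k B c) := by
  refine exists_isNilpotent_sub_algebraMap _ fun q hq ↦ ?_
  let f := IsScalarTower.toAlgHom k B q.ResidueField
  let φ := Algebra.TensorProduct.map (AlgHom.id k A) f
  have hφ : φ u * φ w = 1 := by rw [← map_mul, huw, map_one]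
  obtain ⟨c, hc⟩ := exists_evalAt_eq_smul hφ x y
  refine ⟨c, ?_⟩
  have hy := congrArg (evalAt y _) hφ
  rw [map_mul, map_one] at hy
  simp only [φ, evalAt_map_right] at hc hy
  rw [← Ideal.algebraMap_residueField_eq_zero]
  change f _ = 0
  rw [map_sub, map_mul, hc, smul_mul_assoc, hy, Algebra.smul_def, mul_one, AlgHom.commutes,
    sub_self]

end Connected

section Units

variable {k} {A : Type*} [CommRing A] [Algebra k A]
  {R : Type*} [CommRing R] [Algebra k R] {B : Type*} [CommRing B] [Algebra k B]

lemma nontrivial_quotient_nilradical (R : Type*) [CommRing R] [Nontrivial R] :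
    Nontrivial (R ⧸ nilradical R) :=
  Ideal.Quotient.nontrivial_iff.2 fun h ↦
    not_isNilpotent_one (R := R) (mem_nilradical.1 (h ▸ Submodule.mem_top))

lemma tmul_one_injective [Nontrivial R] :
    Function.Injective fun a : A ↦ (a ⊗ₜ 1 : A ⊗[k] R) :=
  Algebra.TensorProduct.includeLeft_injective (S := k) (algebraMap k R).injective

lemma exists_eq_tmul_one [IsAlgClosed k] [Algebra.FiniteType k A] [IsReduced A] [Nontrivial R]
    {t : A ⊗[k] R} (h : ∀ x : A →ₐ[k] k, ∃ c : k, evalAt x R t = algebraMap k R c) :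
    ∃ a : A, t = a ⊗ₜ 1 := by
  obtain ⟨l, hl⟩ := (Algebra.linearMap k R).exists_leftInverse_of_injective
    (LinearMap.ker_eq_bot.2 (algebraMap k R).injective)
  have hl' (c : k) : l (algebraMap k R c) = c := LinearMap.congr_fun hl c
  let L : A ⊗[k] R →ₗ[k] A := (TensorProduct.rid k A).toLinearMap ∘ₗ l.lTensor A
  have hL (x : A →ₐ[k] k) (s : A ⊗[k] R) : x (L s) = l (evalAt x R s) := by
    induction s with
    | zero => simp
    | tmul a r => simp [L, mul_comm]
    | add s t hs ht => simp only [map_add, hs, ht]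
  refine ⟨L t, sub_eq_zero.1 (eq_zero_of_forall_evalAt_eq_zero fun x ↦ ?_)⟩
  obtain ⟨c, hc⟩ := h x
  rw [map_sub, evalAt_tmul, hL, hc, hl', Algebra.algebraMap_eq_smul_one, sub_self]

/-- Reduction of the second tensor factor modulo its nilradical. -/
noncomputable def modNilradical (k : Type*) [Field k] (A B : Type*) [CommRing A] [Algebra k A]
    [CommRing B] [Algebra k B] : A ⊗[k] B →ₐ[k] A ⊗[k] (B ⧸ nilradical B) :=
  Algebra.TensorProduct.map (AlgHom.id k A) (Ideal.Quotient.mkₐ k (nilradical B))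

@[simp]
lemma modNilradical_tmul (a : A) (b : B) :
    modNilradical k A B (a ⊗ₜ b) = a ⊗ₜ Ideal.Quotient.mk _ b := by
  simp [modNilradical]

lemma evalAt_modNilradical (x : A →ₐ[k] k) (t : A ⊗[k] B) :
    evalAt x _ (modNilradical k A B t) = Ideal.Quotient.mk _ (evalAt x B t) :=
  evalAt_map_right x _ t

lemma tmul_mul_tmul_inv (a : Aˣ) (b : Bˣ) :
    (a : A) ⊗ₜ[k] (b : B) * (↑a⁻¹ : A) ⊗ₜ[k] (↑b⁻¹ : B) = 1 := by
  rw [Algebra.TensorProduct.tmul_mul_tmul, a.mul_inv, b.mul_inv, Algebra.TensorProduct.one_def]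

lemma mem_range_map_of_evalAt_eq_zero (𝔪 : Ideal A) (ε : A →ₐ[k] k)
    (hε : ∀ a, ε a = 0 ↔ a ∈ 𝔪) {z : A ⊗[k] B} (hz : modNilradical k A B z = 0)
    (hεz : evalAt ε B z = 0) :
    z ∈ LinearMap.range (TensorProduct.map (Submodule.restrictScalars k 𝔪).subtype
      (Submodule.restrictScalars k (nilradical B)).subtype) := by
  have hex : Function.Exact (Submodule.restrictScalars k (nilradical B)).subtype
      (Ideal.Quotient.mkₐ k (nilradical B)).toLinearMap := by
    intro b
    simp [Ideal.Quotient.eq_zero_iff_mem]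
  obtain ⟨z, rfl⟩ := (lTensor_exact A hex Ideal.Quotient.mk_surjective z).1 hz
  let p : A →ₗ[k] Submodule.restrictScalars k 𝔪 :=
    (LinearMap.id - Algebra.linearMap k A ∘ₗ ε.toLinearMap).codRestrict _ fun a ↦ by
      simp [← hε]
  have hp (a : A) : (p a : A) = a - ε a • 1 :=
    congrArg (a - ·) (Algebra.algebraMap_eq_smul_one (ε a))
  have key (z : A ⊗[k] Submodule.restrictScalars k (nilradical B)) :
      TensorProduct.map (Submodule.restrictScalars k 𝔪).subtype
        (Submodule.restrictScalars k (nilradical B)).subtype (p.rTensor _ z) =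
      (Submodule.restrictScalars k (nilradical B)).subtype.lTensor A z -
        1 ⊗ₜ evalAt ε B ((Submodule.restrictScalars k (nilradical B)).subtype.lTensor A z) := by
    induction z with
    | zero => simp
    | tmul a b =>
      rw [LinearMap.rTensor_tmul, TensorProduct.map_tmul, LinearMap.lTensor_tmul, evalAt_tmul,
        Submodule.subtype_apply, hp, TensorProduct.sub_tmul, TensorProduct.smul_tmul]
    | add s t hs ht => simp only [map_add, hs, ht, TensorProduct.tmul_add]; abel
  exact ⟨_, (key z).trans (by rw [hεz, TensorProduct.tmul_zero, sub_zero])⟩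

lemma eq_zero_of_mem_range_map (𝔪 : Ideal A) (ε : A →ₐ[k] k)
    (hε : ∀ a, ε a = 0 ↔ a ∈ 𝔪) {z : A ⊗[k] B}
    (hz : z ∈ LinearMap.range (TensorProduct.map (Submodule.restrictScalars k 𝔪).subtype
      (Submodule.restrictScalars k (nilradical B)).subtype)) :
    modNilradical k A B z = 0 ∧ evalAt ε B z = 0 := by
  obtain ⟨z, rfl⟩ := hz
  induction z with
  | zero => simp
  | tmul a b =>
    simp [(hε a).2 a.2, Ideal.Quotient.eq_zero_iff_mem.2 b.2]
  | add s t hs ht => simp [hs, ht]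

variable [IsAlgClosed k]

lemma exists_modNilradical_eq_of_finiteType [Algebra.FiniteType k A] [IsReduced A]
    [ConnectedSpace (PrimeSpectrum A)] [ConnectedSpace (PrimeSpectrum B)] {u w : A ⊗[k] B}
    (huw : u * w = 1) (ε : A →ₐ[k] k) :
    ∃ a : Aˣ, modNilradical k A B u = (a : A) ⊗ₜ Ideal.Quotient.mk _ (evalAt ε B u) := by
  have : Nontrivial B := PrimeSpectrum.nonempty_iff_nontrivial.1 inferInstance
  have := nontrivial_quotient_nilradical B
  have aux {u w : A ⊗[k] B} (huw : u * w = 1) :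
      ∃ a : A, modNilradical k A B (u * 1 ⊗ₜ evalAt ε B w) = a ⊗ₜ 1 := by
    refine exists_eq_tmul_one fun x ↦ ?_
    obtain ⟨c, hc⟩ := exists_isNilpotent_evalAt_sub huw x ε
    refine ⟨c, ?_⟩
    rw [evalAt_modNilradical, map_mul, evalAt_tmul, map_one, one_smul]
    exact (Ideal.Quotient.mk_eq_mk_iff_sub_mem _ _).2 hc
  have hε : evalAt ε B u * evalAt ε B w = 1 := by rw [← map_mul, huw, map_one]
  have hε' : (1 ⊗ₜ evalAt ε B u * 1 ⊗ₜ evalAt ε B w : A ⊗[k] B) = 1 := by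
    rw [Algebra.TensorProduct.tmul_mul_tmul, hε, one_mul, Algebra.TensorProduct.one_def]
  obtain ⟨a, ha⟩ := aux huw
  obtain ⟨a', ha'⟩ := aux ((mul_comm w u).trans huw)
  have haa : a * a' = 1 := by
    refine tmul_one_injective (k := k) (R := B ⧸ nilradical B) ?_
    dsimp only
    rw [← one_mul (1 : B ⧸ nilradical B), ← Algebra.TensorProduct.tmul_mul_tmul, one_mul, ← ha,
      ← ha', ← map_mul, ← Algebra.TensorProduct.one_def]
    convert map_one (modNilradical k A B) using 2
    linear_combination (1 ⊗ₜ evalAt ε B u * 1 ⊗ₜ evalAt ε B w) * huw + hε'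
  refine ⟨⟨a, a', haa, (mul_comm a' a).trans haa⟩, ?_⟩
  have : u = u * 1 ⊗ₜ evalAt ε B w * 1 ⊗ₜ evalAt ε B u := by linear_combination (-u) * hε'
  conv_lhs => rw [this]
  rw [map_mul, ha, modNilradical_tmul, Algebra.TensorProduct.tmul_mul_tmul, one_mul, mul_one]

lemma exists_modNilradical_eq [IsReduced A] [ConnectedSpace (PrimeSpectrum A)]
    [ConnectedSpace (PrimeSpectrum B)] {u w : A ⊗[k] B} (huw : u * w = 1) (ε : A →ₐ[k] k) :
    ∃ a : Aˣ, modNilradical k A B u = (a : A) ⊗ₜ Ideal.Quotient.mk _ (evalAt ε B u) := by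
  obtain ⟨J, hJ, hJuw⟩ := Submodule.exists_fg_le_subset_range_rTensor_subtype
    ({u, w} : Set (A ⊗[k] B)) (Set.toFinite _)
  obtain ⟨s, rfl⟩ := hJ
  let A' := Algebra.adjoin k (s : Set A)
  have : Algebra.FiniteType k A' := (Subalgebra.fg_iff_finiteType _).1 ⟨s, rfl⟩
  have : IsReduced A' := isReduced_of_injective A'.val Subtype.val_injective
  have : ConnectedSpace (PrimeSpectrum A') :=
    connectedSpace_primeSpectrum_of_injective A'.val.toRingHom Subtype.val_injective
  let φ := Algebra.TensorProduct.map A'.val (AlgHom.id k B)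
  have hφ : Function.Injective φ :=
    Module.Flat.rTensor_preserves_injective_linearMap A'.val.toLinearMap Subtype.val_injective
  have lift {t : A ⊗[k] B} (ht : t ∈ ({u, w} : Set (A ⊗[k] B))) : ∃ t', φ t' = t := by
    obtain ⟨t', rfl⟩ := hJuw ht
    refine ⟨(Submodule.inclusion (Algebra.span_le_adjoin k (s : Set A))).rTensor B t', ?_⟩
    change A'.val.toLinearMap.rTensor B _ = _
    rw [← LinearMap.rTensor_comp_apply]
    rfl
  obtain ⟨u, rfl⟩ := lift (.inl rfl)
  obtain ⟨w, rfl⟩ := lift (.inr rfl)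
  have huw' : u * w = 1 := hφ (by rw [map_mul, huw, map_one])
  obtain ⟨a, ha⟩ := exists_modNilradical_eq_of_finiteType huw' (ε.comp A'.val)
  refine ⟨a.map A'.val.toMonoidHom, ?_⟩
  have hcomm (t : A' ⊗[k] B) : modNilradical k A B (φ t) =
      Algebra.TensorProduct.map A'.val (AlgHom.id k _) (modNilradical k A' B t) := by
    induction t with
    | zero => simp
    | tmul a b => simp [φ]
    | add s t hs ht => simp only [map_add, hs, ht]
  rw [hcomm, ha, evalAt_map_left]
  rfl

end Units

lemma isUnitsDirectSum {k : Type u} [Field k] [IsAlgClosed k] (A B : Type u) [CommRing A]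
    [Algebra k A] [CommRing B] [Algebra k B] [IsReduced A] [ConnectedSpace (PrimeSpectrum A)]
    [ConnectedSpace (PrimeSpectrum B)] (𝔪 : Ideal A) [𝔪.IsMaximal]
    (hres : ∀ a : A, ∃ c : k, a - algebraMap k A c ∈ 𝔪) : IsUnitsDirectSum k A B 𝔪 := by
  have : Nontrivial B := PrimeSpectrum.nonempty_iff_nontrivial.1 inferInstance
  have := nontrivial_quotient_nilradical B
  obtain ⟨ε, hε⟩ := exists_point_of_isMaximal 𝔪 hres
  constructor
  · intro u
    obtain ⟨a, ha⟩ := exists_modNilradical_eq u.mul_inv ε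
    let b : Bˣ := u.map (evalAt ε B).toMonoidHom
    have hεa : ε a = 1 := by
      have h := congrArg (evalAt ε _) ha
      rw [evalAt_modNilradical, evalAt_tmul] at h
      have hb := congrArg (Ideal.Quotient.mk (nilradical B)) b.mul_inv
      rw [map_mul, map_one] at hb
      have h1 : algebraMap k (B ⧸ nilradical B) (ε a) = algebraMap k (B ⧸ nilradical B) 1 := by
        rw [Algebra.algebraMap_eq_smul_one, map_one, ← hb, ← smul_mul_assoc]
        exact congrArg (· * _) h.symm
      exact (algebraMap k (B ⧸ nilradical B)).injective h1
    have hs := tmul_mul_tmul_inv (k := k) a b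
    refine ⟨_, ⟨a, b, rfl⟩, (u : A ⊗[k] B) * ((↑a⁻¹ : A) ⊗ₜ[k] (↑b⁻¹ : B)),
      ⟨_, mem_range_map_of_evalAt_eq_zero 𝔪 ε hε
        (z := (u : A ⊗[k] B) * ((↑a⁻¹ : A) ⊗ₜ[k] (↑b⁻¹ : B)) - 1)
        ?_ ?_, by ring⟩, by linear_combination (-(u : A ⊗[k] B)) * hs⟩
    · rw [map_sub, map_mul, ha, map_one, sub_eq_zero]
      exact (map_mul (modNilradical k A B) ((a : A) ⊗ₜ (b : B)) _).symm.trans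
        ((congrArg _ hs).trans (map_one _))
    · have h := congrArg (evalAt ε B) hs
      rw [map_mul, evalAt_tmul, hεa, one_smul, map_one] at h
      rw [map_sub, map_mul, map_one, sub_eq_zero]
      exact h
  · rintro _ ⟨a, b, rfl⟩ _ ⟨a', b', rfl⟩ _ ⟨x, hx, rfl⟩ _ ⟨x', hx', rfl⟩ h
    obtain ⟨hx, hεx⟩ := eq_zero_of_mem_range_map 𝔪 ε hε hx
    obtain ⟨hx', hεx'⟩ := eq_zero_of_mem_range_map 𝔪 ε hε hx'
    have hε1 := congrArg (evalAt ε B) h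
    have hn := congrArg (modNilradical k A B) h
    simp only [map_mul, map_add, map_one, hεx, hεx', hx, hx', add_zero, mul_one, evalAt_tmul,
      modNilradical_tmul] at hε1 hn
    have hεa' : ε a' ≠ 0 := (a'.isUnit.map ε).ne_zero
    have hb : (b' : B) = ((ε a')⁻¹ * ε a) • (b : B) := by
      rw [mul_smul, hε1, inv_smul_smul₀ hεa']
    have hbb := congrArg (Ideal.Quotient.mk (nilradical B)) b.mul_inv
    rw [map_mul, map_one] at hbb
    have ha : (a : A) = ((ε a')⁻¹ * ε a) • (a' : A) := by
      refine tmul_one_injective (k := k) (R := B ⧸ nilradical B) ?_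
      have hn' := congrArg (· * 1 ⊗ₜ Ideal.Quotient.mk (nilradical B) (↑b⁻¹ : B)) hn
      have hmk : Ideal.Quotient.mk (nilradical B) b' =
          ((ε a')⁻¹ * ε a) • Ideal.Quotient.mk (nilradical B) b := by
        rw [hb]
        rfl
      simpa only [Algebra.TensorProduct.tmul_mul_tmul, mul_one, hbb, hmk, smul_mul_assoc,
        TensorProduct.smul_tmul] using hn'
    have hs : (a : A) ⊗ₜ[k] (b : B) = (a' : A) ⊗ₜ[k] (b' : B) := by
      rw [ha, hb, TensorProduct.smul_tmul]
    refine ⟨hs, ?_⟩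
    rw [← hs] at h
    linear_combination ((↑a⁻¹ : A) ⊗ₜ[k] (↑b⁻¹ : B)) * h -
      (x - x') * tmul_mul_tmul_inv (k := k) a b

/-- if `B` has finitely many idempotents and `B = B₁ × ⋯ × Bₙ` with
each `Spec Bᵢ` connected, then under the induced identification
`A ⊗_k B ≅ Π i, A ⊗_k Bᵢ` every unit decomposes componentwise as
`(aᵢ ⊗ bᵢ)(1 + xᵢ)`, and for each `i` the group `(A ⊗_k Bᵢ)^×` is the internal
direct sum of `A^×Bᵢ^×` and `1 + 𝔪 ⊗ Nil(Bᵢ)`. -/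
theorem units_directSum_finitely_many_idempotents {k : Type u} [Field k]
    [IsAlgClosed k] (A B : Type u) [CommRing A] [Algebra k A] [CommRing B]
    [Algebra k B] [IsReduced A] [ConnectedSpace (PrimeSpectrum A)]
    (𝔪 : Ideal A) [𝔪.IsMaximal]
    (hres : ∀ a : A, ∃ c : k, a - algebraMap k A c ∈ 𝔪)
    (hidem : { b : B | IsIdempotentElem b }.Finite)
    (n : ℕ) (Bi : Fin n → Type u) [∀ i, CommRing (Bi i)] [∀ i, Algebra k (Bi i)]
    [∀ i, ConnectedSpace (PrimeSpectrum (Bi i))]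
    (e : B ≃ₐ[k] ∀ i, Bi i)
    (Φ : (A ⊗[k] B) ≃ₐ[k] ∀ i, A ⊗[k] Bi i)
    (hΦ : ∀ (a : A) (b : B), Φ (a ⊗ₜ[k] b) = fun i => a ⊗ₜ[k] (e b i)) :
    (∀ (u : (A ⊗[k] B)ˣ) (i : Fin n), ∃ s ∈ unitsS1 k A (Bi i),
        ∃ t ∈ unitsS2 k A (Bi i) 𝔪, Φ (u : A ⊗[k] B) i = s * t) ∧
    ∀ i, IsUnitsDirectSum k A (Bi i) 𝔪 := by
  have h i : IsUnitsDirectSum k A (Bi i) 𝔪 := isUnitsDirectSum A (Bi i) 𝔪 hres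
  exact ⟨fun u i ↦ (h i).1
    (u.map ((Pi.evalRingHom (fun i ↦ A ⊗[k] Bi i) i).comp Φ.toRingEquiv.toRingHom).toMonoidHom), h⟩
end
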